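/- Let n, N ≥ 1 and J : ℝⁿ → ℝ^{(6N)×n}. The following are equivalent: (i) there exist constants 0 < β₁ ≤ β₂ < ∞ such that for all q ∈ ℝⁿ both J(q)ᵀJ(q) − β₁·I_n and β₂·I_n − J(q)ᵀJ(q) are positive semidefinite; (ii) for every constant Θ = (Φ₁,…,Φ_N) ∈ ℝ^{10N} such that f(Φ_l) is positive definite for every l ∈ {1,…,N}, there exist constants 0 < α₁ ≤ α₂ < ∞ such that for all q ∈ ℝⁿ both M(q,Θ) − α₁·I_n and α₂·I_n − M(q,Θ) are positive semidefinite. -/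

import Mathlib

noncomputable section

open Matrix

/-- The skew-symmetric cross-product matrix `𝒮(x)` with `𝒮(x) y = x × y`. -/
def crossMat (x : Fin 3 → ℝ) : Matrix (Fin 3) (Fin 3) ℝ :=
  !![0, -x 2, x 1; x 2, 0, -x 0; -x 1, x 0, 0]

/-- The first moment of mass `h = (h₁,h₂,h₃)` from `Φ`. -/
def hVec (Φ : Fin 10 → ℝ) : Fin 3 → ℝ := ![Φ 1, Φ 2, Φ 3]

/-- The inertia matrix `I` from `Φ = (m,h₁,h₂,h₃,I₁₁,I₂₂,I₃₃,I₁₂,I₂₃,I₁₃)`. -/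
def Imat (Φ : Fin 10 → ℝ) : Matrix (Fin 3) (Fin 3) ℝ :=
  !![Φ 4, Φ 7, Φ 9; Φ 7, Φ 5, Φ 8; Φ 9, Φ 8, Φ 6]

/-- `Σ = (1/2)·tr(I)·I₃ − I`. -/
def SigmaMat (Φ : Fin 10 → ℝ) : Matrix (Fin 3) (Fin 3) ℝ :=
  ((1 / 2 : ℝ) * (Imat Φ).trace) • (1 : Matrix (Fin 3) (Fin 3) ℝ) - Imat Φ

/-- The 4×4 matrix `f(Φ) = [[Σ, h],[hᵀ, m]]`. -/
def fMat (Φ : Fin 10 → ℝ) : Matrix (Fin 3 ⊕ Fin 1) (Fin 3 ⊕ Fin 1) ℝ :=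
  Matrix.fromBlocks (SigmaMat Φ) (Matrix.of fun i _ => hVec Φ i)
    (Matrix.of fun _ j => hVec Φ j) (Matrix.of fun _ _ => Φ 0)

/-- The 6×6 matrix `Z(Φ) = [[m·I₃, −𝒮(h)],[−𝒮(h)ᵀ, I]]`. -/
def ZMat (Φ : Fin 10 → ℝ) : Matrix (Fin 3 ⊕ Fin 3) (Fin 3 ⊕ Fin 3) ℝ :=
  Matrix.fromBlocks (Φ 0 • (1 : Matrix (Fin 3) (Fin 3) ℝ)) (-(crossMat (hVec Φ)))
    (-(crossMat (hVec Φ))ᵀ) (Imat Φ)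

/-- `𝒵(Θ) = blockdiag(Z(Φ₁),…,Z(Φ_N))`. -/
def calZ {N : ℕ} (Θ : Fin N → Fin 10 → ℝ) :
    Matrix ((Fin 3 ⊕ Fin 3) × Fin N) ((Fin 3 ⊕ Fin 3) × Fin N) ℝ :=
  Matrix.blockDiagonal fun l => ZMat (Θ l)

/-- The mass matrix `M(q,Θ) = J(q)ᵀ 𝒵(Θ) J(q)`. -/
def massMatrix {n N : ℕ}
    (J : (Fin n → ℝ) → Matrix ((Fin 3 ⊕ Fin 3) × Fin N) (Fin n) ℝ)
    (Θ : Fin N → Fin 10 → ℝ) (q : Fin n → ℝ) : Matrix (Fin n) (Fin n) ℝ :=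
  (J q)ᵀ * calZ Θ * J q

theorem Matrix.IsHermitian.posSemidef_sub_smul_one {ι : Type*} [Fintype ι] [DecidableEq ι]
    {A : Matrix ι ι ℝ} (hA : A.IsHermitian) {c : ℝ} (hc : ∀ i, c ≤ hA.eigenvalues i) :
    (A - c • (1 : Matrix ι ι ℝ)).PosSemidef := by
  have h : A - c • (1 : Matrix ι ι ℝ) = (hA.eigenvectorUnitary : Matrix ι ι ℝ) *
      diagonal (fun i => hA.eigenvalues i - c) *
        (hA.eigenvectorUnitary : Matrix ι ι ℝ)ᴴ := by
    have hd : diagonal (fun i => hA.eigenvalues i - c) =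
        diagonal hA.eigenvalues - c • (1 : Matrix ι ι ℝ) := by
      rw [smul_one_eq_diagonal, diagonal_sub]
    have hU : (hA.eigenvectorUnitary : Matrix ι ι ℝ) *
        (hA.eigenvectorUnitary : Matrix ι ι ℝ)ᴴ = 1 :=
      Unitary.coe_mul_star_self hA.eigenvectorUnitary
    have hs := hA.spectral_theorem
    rw [Unitary.conjStarAlgAut_apply] at hs
    rw [hd, mul_sub, sub_mul, mul_smul_comm, smul_mul_assoc, mul_one, hU]
    exact congrArg (· - c • (1 : Matrix ι ι ℝ)) hs
  rw [h]
  exact (PosSemidef.diagonal fun i => sub_nonneg.2 (hc i)).mul_mul_conjTranspose_same _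

theorem Matrix.IsHermitian.exists_posSemidef_smul_one_sub {ι : Type*} [Fintype ι] [DecidableEq ι]
    {A : Matrix ι ι ℝ} (hA : A.IsHermitian) (b : ℝ) :
    ∃ C, b ≤ C ∧ (C • (1 : Matrix ι ι ℝ) - A).PosSemidef := by
  obtain ⟨c, hc⟩ := (Set.finite_range hA.neg.eigenvalues).bddBelow
  refine ⟨max b (-c), le_max_left _ _, ?_⟩
  have h := hA.neg.posSemidef_sub_smul_one (c := -max b (-c)) fun i =>
    (neg_le.1 (le_max_right b (-c))).trans (hc ⟨i, rfl⟩)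
  convert h using 1
  module

theorem Matrix.PosDef.exists_posSemidef_sub_smul_one {ι : Type*} [Fintype ι] [DecidableEq ι]
    {A : Matrix ι ι ℝ} (hA : A.PosDef) :
    ∃ c : ℝ, 0 < c ∧ (A - c • (1 : Matrix ι ι ℝ)).PosSemidef := by
  rcases isEmpty_or_nonempty ι with _ | _
  · exact ⟨1, one_pos, by
      rw [Subsingleton.elim (A - (1 : ℝ) • (1 : Matrix ι ι ℝ)) 0]; exact .zero⟩
  · obtain ⟨i, hi⟩ := Finite.exists_min hA.1.eigenvalues
    exact ⟨_, hA.eigenvalues_pos i, hA.1.posSemidef_sub_smul_one hi⟩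

theorem Matrix.PosDef.blockDiagonal {ι κ : Type*} [Fintype ι] [Fintype κ] [DecidableEq κ]
    {A : κ → Matrix ι ι ℝ} (hA : ∀ k, (A k).PosDef) : (blockDiagonal A).PosDef := by
  refine .of_dotProduct_mulVec_pos (isHermitian_blockDiagonal_iff.2 fun k => (hA k).1)
    fun x hx => ?_
  have h : star x ⬝ᵥ (Matrix.blockDiagonal A *ᵥ x) =
      ∑ k, star (fun i => x (i, k)) ⬝ᵥ (A k *ᵥ fun i => x (i, k)) := by
    simp only [dotProduct, mulVec, blockDiagonal_apply, Fintype.sum_prod_type, ite_mul, zero_mul,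
      Finset.sum_ite_eq, Finset.mem_univ, if_true, Pi.star_apply]
    exact Finset.sum_comm
  rw [h]
  obtain ⟨⟨i, k⟩, hik⟩ := Function.ne_iff.1 hx
  refine Finset.sum_pos' (fun l _ => (hA l).posSemidef.dotProduct_mulVec_nonneg _)
    ⟨k, Finset.mem_univ k, (hA k).dotProduct_mulVec_pos fun h0 => hik (congrFun h0 i)⟩

/-- With `v = x ∘ inl` and `ω = x ∘ inr`, the rows of the velocity map `(p, 1) ↦ v + ω × p`. -/
def velocityRow (x : Fin 3 ⊕ Fin 3 → ℝ) (k : Fin 3) : Fin 3 ⊕ Fin 1 → ℝ :=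
  Sum.elim (crossMat (fun i => x (.inr i)) k) fun _ => x (.inl k)

/-- The kinetic energy is the trace of the pseudo-inertia matrix conjugated by the velocity map. -/
theorem dotProduct_ZMat_mulVec (Φ : Fin 10 → ℝ) (x : Fin 3 ⊕ Fin 3 → ℝ) :
    x ⬝ᵥ (ZMat Φ *ᵥ x) = ∑ k, velocityRow x k ⬝ᵥ (fMat Φ *ᵥ velocityRow x k) := by
  simp [ZMat, fMat, velocityRow, SigmaMat, Imat, hVec, crossMat, dotProduct, mulVec,
    Fin.sum_univ_three, trace, one_apply, fromBlocks]
  ring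

theorem exists_velocityRow_ne_zero {x : Fin 3 ⊕ Fin 3 → ℝ} (hx : x ≠ 0) :
    ∃ k, velocityRow x k ≠ 0 := by
  by_contra! h
  have hv : ∀ k, x (.inl k) = 0 := fun k => congrFun (h k) (.inr 0)
  have h0 : x (.inr 0) = 0 := by simpa [velocityRow, crossMat] using congrFun (h 2) (.inl 1)
  have h1 : x (.inr 1) = 0 := by simpa [velocityRow, crossMat] using congrFun (h 0) (.inl 2)
  have h2 : x (.inr 2) = 0 := by simpa [velocityRow, crossMat] using congrFun (h 1) (.inl 0)
  refine hx (funext ?_)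
  rintro (i | i)
  · exact hv i
  · fin_cases i <;> assumption

theorem ZMat_isHermitian (Φ : Fin 10 → ℝ) : (ZMat Φ).IsHermitian := by
  refine IsHermitian.fromBlocks (by simp [IsHermitian])
    (by simp [conjTranspose_eq_transpose_of_trivial]) ?_
  ext i j
  fin_cases i <;> fin_cases j <;> rfl

theorem ZMat_posDef {Φ : Fin 10 → ℝ} (hΦ : (fMat Φ).PosDef) : (ZMat Φ).PosDef := by
  refine .of_dotProduct_mulVec_pos (ZMat_isHermitian Φ) fun x hx => ?_
  rw [star_trivial, dotProduct_ZMat_mulVec]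
  obtain ⟨k, hk⟩ := exists_velocityRow_ne_zero hx
  exact Finset.sum_pos' (fun l _ => hΦ.posSemidef.dotProduct_mulVec_nonneg _)
    ⟨k, Finset.mem_univ k, hΦ.dotProduct_mulVec_pos hk⟩

/-- The parameters of a body of unit mass centred at the origin, with identity inertia matrix. -/
def unitBody : Fin 10 → ℝ := ![1, 0, 0, 0, 1, 1, 1, 0, 0, 0]

theorem fMat_unitBody_posDef : (fMat unitBody).PosDef := by
  have h : fMat unitBody = diagonal (Sum.elim (fun _ => 1 / 2) fun _ => 1) := by
    ext (i | i) (j | j) <;> fin_cases i <;> fin_cases j <;>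
      simp [fMat, SigmaMat, Imat, hVec, unitBody, trace, Fin.sum_univ_three] <;> norm_num
  rw [h]
  refine .diagonal ?_
  rintro (i | i) <;> norm_num

theorem ZMat_unitBody : ZMat unitBody = 1 := by
  ext (i | i) (j | j) <;> fin_cases i <;> fin_cases j <;>
    simp [ZMat, Imat, hVec, unitBody, crossMat, one_apply]

theorem calZ_unitBody {N : ℕ} : calZ (fun _ : Fin N => unitBody) = 1 := by
  simp only [calZ, ZMat_unitBody]
  exact blockDiagonal_one

/-- The Jacobian is normal and uniformly upper bounded iff for every constant physically
consistent set of inertial parameters the mass matrix has finite positive uniform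
bounds. -/
theorem jacobian_bounds_iff_massMatrix_bounds {n N : ℕ} (hn : 1 ≤ n) (hN : 1 ≤ N)
    (J : (Fin n → ℝ) → Matrix ((Fin 3 ⊕ Fin 3) × Fin N) (Fin n) ℝ) :
    (∃ β₁ β₂ : ℝ, 0 < β₁ ∧ β₁ ≤ β₂ ∧
        ∀ q, ((J q)ᵀ * J q - β₁ • (1 : Matrix (Fin n) (Fin n) ℝ)).PosSemidef ∧
          (β₂ • (1 : Matrix (Fin n) (Fin n) ℝ) - (J q)ᵀ * J q).PosSemidef) ↔
      ∀ Θ : Fin N → Fin 10 → ℝ, (∀ l, (fMat (Θ l)).PosDef) →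
        ∃ α₁ α₂ : ℝ, 0 < α₁ ∧ α₁ ≤ α₂ ∧
          ∀ q, (massMatrix J Θ q - α₁ • (1 : Matrix (Fin n) (Fin n) ℝ)).PosSemidef ∧
            (α₂ • (1 : Matrix (Fin n) (Fin n) ℝ) - massMatrix J Θ q).PosSemidef := by
  constructor
  · rintro ⟨β₁, β₂, hβ₁, hβ, hJ⟩ Θ hΘ
    have hZ : (calZ Θ).PosDef := .blockDiagonal fun l => ZMat_posDef (hΘ l)
    obtain ⟨c, hc, hcZ⟩ := hZ.exists_posSemidef_sub_smul_one
    obtain ⟨C, hcC, hCZ⟩ := hZ.1.exists_posSemidef_smul_one_sub c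
    refine ⟨c * β₁, C * β₂, mul_pos hc hβ₁, mul_le_mul hcC hβ hβ₁.le (hc.le.trans hcC),
      fun q => ⟨?_, ?_⟩⟩
    · convert (hcZ.conjTranspose_mul_mul_same (J q)).add ((hJ q).1.smul hc.le) using 1
      simp only [massMatrix, conjTranspose_eq_transpose_of_trivial, Matrix.mul_sub, Matrix.sub_mul,
        Matrix.mul_smul, Matrix.smul_mul, Matrix.mul_one]
      module
    · convert (hCZ.conjTranspose_mul_mul_same (J q)).add
        ((hJ q).2.smul (hc.le.trans hcC)) using 1
      simp only [massMatrix, conjTranspose_eq_transpose_of_trivial, Matrix.mul_sub, Matrix.sub_mul,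
        Matrix.mul_smul, Matrix.smul_mul, Matrix.mul_one]
      module
  · intro h
    simpa only [massMatrix, calZ_unitBody, Matrix.mul_one] using
      h (fun _ => unitBody) fun _ => fMat_unitBody_posDef

end
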